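/- The Levi–Civita scalar curvature satisfies R = −4·ν⁽⁰⁾_{ρ_g} − ν⁽¹⁾ + Σ_{A,B,C,D} g^{AB}·Γ^D{}_{BC}·Γ^C{}_{DA} pointwise on U. -/

import Mathlib

/-- The `A`-th partial derivative of a function `f : ℝⁿ → ℝ`. -/
noncomputable def pd {n : ℕ} (A : Fin n) (f : (Fin n → ℝ) → ℝ) (z : Fin n → ℝ) : ℝ :=
  fderiv ℝ f z (Pi.single A 1)

/-- The Laplacian `Δ_ρ f := (1/ρ)·Σ_{A,B} ∂_A(ρ g^{AB} ∂_B f)`. -/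
noncomputable def lap {n : ℕ} (ρ : (Fin n → ℝ) → ℝ) (g : (Fin n → ℝ) → Fin n → Fin n → ℝ)
    (f : (Fin n → ℝ) → ℝ) (z : Fin n → ℝ) : ℝ :=
  (ρ z)⁻¹ * ∑ A, ∑ B, pd A (fun w => ρ w * g w A B * pd B f w) z

/-- `ν⁽⁰⁾_ρ := (1/√ρ)·Δ₁(√ρ)`. -/
noncomputable def nuZero {n : ℕ} (ρ : (Fin n → ℝ) → ℝ) (g : (Fin n → ℝ) → Fin n → Fin n → ℝ)
    (z : Fin n → ℝ) : ℝ :=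
  (Real.sqrt (ρ z))⁻¹ * lap (fun _ => 1) g (fun w => Real.sqrt (ρ w)) z

/-- `ν⁽¹⁾ := Σ ∂_A∂_B g^{AB}`. -/
noncomputable def nuOne {n : ℕ} (g : (Fin n → ℝ) → Fin n → Fin n → ℝ) (z : Fin n → ℝ) : ℝ :=
  ∑ A, ∑ B, pd A (pd B (fun u => g u A B)) z

/-- `ν⁽²⁾ := Σ (∂_D g^{AB}) g_{BC} (∂_A g^{CD})`; `gl` denotes the lower-index inverse metric. -/
noncomputable def nuTwo {n : ℕ} (g gl : (Fin n → ℝ) → Fin n → Fin n → ℝ) (z : Fin n → ℝ) : ℝ :=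
  ∑ A, ∑ B, ∑ C, ∑ D,
    pd D (fun u => g u A B) z * gl z B C * pd A (fun u => g u C D) z

/-- `ν⁽³⁾ := Σ (∂_C g_{AB}) g^{CD} (∂_D g^{BA})`. -/
noncomputable def nuThree {n : ℕ} (g gl : (Fin n → ℝ) → Fin n → Fin n → ℝ) (z : Fin n → ℝ) : ℝ :=
  ∑ A, ∑ B, ∑ C, ∑ D,
    pd C (fun u => gl u A B) z * g z C D * pd D (fun u => gl u B A) z

/-- `ν_ρ := ν⁽⁰⁾_ρ + ν⁽¹⁾/4 − ν⁽²⁾/8 − ν⁽³⁾/16`. -/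
noncomputable def nuRho {n : ℕ} (ρ : (Fin n → ℝ) → ℝ) (g gl : (Fin n → ℝ) → Fin n → Fin n → ℝ)
    (z : Fin n → ℝ) : ℝ :=
  nuZero ρ g z + nuOne g z / 4 - nuTwo g gl z / 8 - nuThree g gl z / 16

/-- Lowered Levi–Civita Christoffel symbols
`Γ_{CAB} := ½(∂_A g_{CB} + ∂_B g_{CA} − ∂_C g_{AB})`. -/
noncomputable def christLow {n : ℕ} (gl : (Fin n → ℝ) → Fin n → Fin n → ℝ)
    (C A B : Fin n) (z : Fin n → ℝ) : ℝ :=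
  (pd A (fun u => gl u C B) z + pd B (fun u => gl u C A) z - pd C (fun u => gl u A B) z) / 2

/-- Levi–Civita Christoffel symbols `Γ^A{}_{BC} := Σ_D g^{AD} Γ_{DBC}`. -/
noncomputable def christ {n : ℕ} (g gl : (Fin n → ℝ) → Fin n → Fin n → ℝ)
    (A B C : Fin n) (z : Fin n → ℝ) : ℝ :=
  ∑ D, g z A D * christLow gl D B C z

/-- Riemann curvature
`R^D{}_{ABC} := ∂_A Γ^D{}_{BC} − ∂_B Γ^D{}_{AC} + Σ_E (Γ^D{}_{AE}Γ^E{}_{BC} − Γ^D{}_{BE}Γ^E{}_{AC})`. -/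
noncomputable def riem {n : ℕ} (g gl : (Fin n → ℝ) → Fin n → Fin n → ℝ)
    (D A B C : Fin n) (z : Fin n → ℝ) : ℝ :=
  pd A (christ g gl D B C) z - pd B (christ g gl D A C) z
    + ∑ E, (christ g gl D A E z * christ g gl E B C z
            - christ g gl D B E z * christ g gl E A C z)

/-- Ricci tensor `R_{AB} := Σ_C R^C{}_{CAB}`. -/
noncomputable def ricci {n : ℕ} (g gl : (Fin n → ℝ) → Fin n → Fin n → ℝ)
    (A B : Fin n) (z : Fin n → ℝ) : ℝ :=
  ∑ C, riem g gl C C A B z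

/-- Scalar curvature `R := Σ g^{BA} R_{AB}`. -/
noncomputable def scal {n : ℕ} (g gl : (Fin n → ℝ) → Fin n → Fin n → ℝ)
    (z : Fin n → ℝ) : ℝ :=
  ∑ A, ∑ B, g z B A * ricci g gl A B z

/-- Canonical density `ρ_g := √(det(g_{AB}))`. -/
noncomputable def rhoG {n : ℕ} (gl : (Fin n → ℝ) → Fin n → Fin n → ℝ) (z : Fin n → ℝ) : ℝ :=
  Real.sqrt (Matrix.det (Matrix.of fun A B => gl z A B))

open Finset

theorem pd_congr_of_eqOn {n : ℕ} {U : Set (Fin n → ℝ)} (hU : IsOpen U)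
    {f h : (Fin n → ℝ) → ℝ} (hfh : ∀ w ∈ U, f w = h w) {z : Fin n → ℝ} (hz : z ∈ U)
    (A : Fin n) : pd A f z = pd A h z := by
  unfold pd
  rw [Filter.EventuallyEq.fderiv_eq (Filter.eventually_of_mem (hU.mem_nhds hz) hfh)]

theorem pd_const {n : ℕ} (A : Fin n) (c : ℝ) (z : Fin n → ℝ) : pd A (fun _ => c) z = 0 := by
  simp [pd]

theorem pd_mul {n : ℕ} {f h : (Fin n → ℝ) → ℝ} {z : Fin n → ℝ}
    (hf : DifferentiableAt ℝ f z) (hh : DifferentiableAt ℝ h z) (A : Fin n) :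
    pd A (fun w => f w * h w) z = pd A f z * h z + f z * pd A h z := by
  unfold pd
  rw [fderiv_fun_mul hf hh]
  simp
  ring

theorem pd_sum {n : ℕ} {ι : Type*} (s : Finset ι) {f : ι → (Fin n → ℝ) → ℝ} {z : Fin n → ℝ}
    (hf : ∀ i, DifferentiableAt ℝ (f i) z) (A : Fin n) :
    pd A (fun w => ∑ i ∈ s, f i w) z = ∑ i ∈ s, pd A (f i) z := by
  unfold pd
  rw [fderiv_fun_sum fun i _ => hf i]
  simp

theorem pd_neg_sub {n : ℕ} {f h : (Fin n → ℝ) → ℝ} {z : Fin n → ℝ}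
    (hf : DifferentiableAt ℝ f z) (hh : DifferentiableAt ℝ h z) (A : Fin n) :
    pd A (fun w => -f w - h w) z = -pd A f z - pd A h z := by
  unfold pd
  rw [fderiv_fun_sub hf.fun_neg hh, fderiv_fun_neg]
  simp

theorem contDiffOn_pd {n : ℕ} {U : Set (Fin n → ℝ)} (hU : IsOpen U) {f : (Fin n → ℝ) → ℝ}
    (hf : ContDiffOn ℝ (⊤ : ℕ∞) f U) (A : Fin n) : ContDiffOn ℝ (⊤ : ℕ∞) (pd A f) U := by
  unfold pd
  exact (hf.fderiv_of_isOpen hU (m := (⊤ : ℕ∞)) (by simp)).clm_apply contDiffOn_const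

theorem differentiableAt_of_contDiffOn {n : ℕ} {U : Set (Fin n → ℝ)} (hU : IsOpen U)
    {f : (Fin n → ℝ) → ℝ} (hf : ContDiffOn ℝ (⊤ : ℕ∞) f U) {z : Fin n → ℝ} (hz : z ∈ U) :
    DifferentiableAt ℝ f z :=
  (hf.contDiffAt (hU.mem_nhds hz)).differentiableAt (by simp)

theorem contDiffOn_det {n : ℕ} {U : Set (Fin n → ℝ)}
    {M : (Fin n → ℝ) → Matrix (Fin n) (Fin n) ℝ}
    (hM : ∀ A B, ContDiffOn ℝ (⊤ : ℕ∞) (fun z => M z A B) U) :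
    ContDiffOn ℝ (⊤ : ℕ∞) (fun z => (M z).det) U := by
  simp only [Matrix.det_apply']
  exact ContDiffOn.sum fun σ _ => contDiffOn_const.mul (contDiffOn_prod fun i _ => hM _ _)

/-- Jacobi's formula for the derivative of a determinant. -/
theorem pd_det {n : ℕ} {M : (Fin n → ℝ) → Matrix (Fin n) (Fin n) ℝ} {z : Fin n → ℝ}
    (hM : ∀ A B, DifferentiableAt ℝ (fun w => M w A B) z) (A : Fin n) :
    pd A (fun w => (M w).det) z
      = ∑ B, ∑ C, (M z).adjugate B C * pd A (fun w => M w C B) z := by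
  have hprod : ∀ σ : Equiv.Perm (Fin n), pd A (fun w => ∏ j, M w (σ j) j) z
      = ∑ B, (∏ j ∈ univ.erase B, M z (σ j) j) * pd A (fun w => M w (σ B) B) z := by
    intro σ
    unfold pd
    rw [fderiv_finsetProd fun i _ => hM (σ i) i]
    simp
  have hdp : ∀ σ : Equiv.Perm (Fin n), DifferentiableAt ℝ (fun w => ∏ j, M w (σ j) j) z :=
    fun σ => (HasFDerivAt.finsetProd fun i _ => (hM (σ i) i).hasFDerivAt).differentiableAt
  have hcol : ∀ B, (∑ C, (M z).adjugate B C * pd A (fun w => M w C B) z)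
      = ((M z).updateCol B fun C => pd A (fun w => M w C B) z).det := by
    intro B
    rw [← Matrix.cramer_apply, Matrix.cramer_eq_adjugate_mulVec]
    rfl
  simp only [hcol, Matrix.det_apply']
  rw [pd_sum _ fun σ => (differentiableAt_const _).fun_mul (hdp σ), sum_comm]
  refine sum_congr rfl fun σ _ => ?_
  rw [pd_mul (differentiableAt_const _) (hdp σ), pd_const, hprod, zero_mul, zero_add, mul_sum]
  refine sum_congr rfl fun B _ => ?_
  rw [← mul_prod_erase univ _ (mem_univ B), Matrix.updateCol_self, mul_comm (∏ j ∈ _, _)]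
  congr 2
  refine prod_congr rfl fun j hj => ?_
  rw [Matrix.updateCol_ne (ne_of_mem_erase hj)]

/-- `g` is a smooth Riemannian metric on `U` in contravariant form, with inverse `gl`. -/
structure IsMetricOn {n : ℕ} (U : Set (Fin n → ℝ)) (g gl : (Fin n → ℝ) → Fin n → Fin n → ℝ) :
    Prop where
  isOpen : IsOpen U
  smooth : ∀ A B, ContDiffOn ℝ (⊤ : ℕ∞) (fun z => g z A B) U
  symm : ∀ z ∈ U, ∀ A B, g z A B = g z B A
  inv : ∀ z ∈ U, ∀ A C, ∑ B, gl z A B * g z B C = if A = C then 1 else 0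
  pos : ∀ z ∈ U, (Matrix.of fun A B => gl z A B).PosDef

namespace IsMetricOn

variable {n : ℕ} {U : Set (Fin n → ℝ)} {g gl : (Fin n → ℝ) → Fin n → Fin n → ℝ}
  {z : Fin n → ℝ}

theorem lower_mul_upper (h : IsMetricOn U g gl) (hz : z ∈ U) :
    Matrix.of (gl z) * Matrix.of (g z) = 1 := by
  ext A C
  rw [Matrix.mul_apply, Matrix.one_apply]
  exact h.inv z hz A C

theorem upper_mul_lower (h : IsMetricOn U g gl) (hz : z ∈ U) (A C : Fin n) :
    ∑ B, g z A B * gl z B C = if A = C then 1 else 0 := by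
  have := congrArg (fun M => M A C) (mul_eq_one_comm.1 (h.lower_mul_upper hz))
  beta_reduce at this
  rwa [Matrix.mul_apply, Matrix.one_apply] at this

theorem lower_symm (h : IsMetricOn U g gl) (hz : z ∈ U) (A B : Fin n) :
    gl z A B = gl z B A := by
  simpa using (h.pos z hz).isHermitian.apply B A

theorem adjugate_lower (h : IsMetricOn U g gl) (hz : z ∈ U) :
    (Matrix.of (gl z)).adjugate = (Matrix.of (gl z)).det • Matrix.of (g z) := by
  rw [← mul_one (Matrix.adjugate _), ← h.lower_mul_upper hz, ← mul_assoc,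
    Matrix.adjugate_mul, Matrix.smul_mul, one_mul]

theorem smooth_lower (h : IsMetricOn U g gl) (A B : Fin n) :
    ContDiffOn ℝ (⊤ : ℕ∞) (fun z => gl z A B) U := by
  have heq : ∀ z ∈ U, gl z A B
      = ((Matrix.of (g z)).det)⁻¹ * ((Matrix.of (g z)).updateRow B (Pi.single A 1)).det := by
    intro z hz
    have h1 : Matrix.of (gl z) = (Matrix.of (g z))⁻¹ :=
      (Matrix.inv_eq_left_inv (h.lower_mul_upper hz)).symm
    have h2 := congrFun (congrFun h1 A) B
    rw [Matrix.inv_def, Ring.inverse_eq_inv, Matrix.smul_apply, Matrix.adjugate_apply] at h2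
    exact h2
  refine ContDiffOn.congr (ContDiffOn.mul (ContDiffOn.inv (contDiffOn_det h.smooth) ?_)
    (contDiffOn_det fun C D => ?_)) heq
  · intro z hz h0
    have := congrArg Matrix.det (h.lower_mul_upper hz)
    rw [Matrix.det_mul, Matrix.det_one] at this
    have h0' : (Matrix.of (g z)).det = 0 := h0
    simp [h0'] at this
  · by_cases hC : C = B
    · subst hC
      simpa using contDiffOn_const
    · simpa [Matrix.updateRow_ne hC] using h.smooth C D

theorem differentiableAt_upper (h : IsMetricOn U g gl) (hz : z ∈ U) (A B : Fin n) :
    DifferentiableAt ℝ (fun w => g w A B) z :=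
  differentiableAt_of_contDiffOn h.isOpen (h.smooth A B) hz

theorem differentiableAt_lower (h : IsMetricOn U g gl) (hz : z ∈ U) (A B : Fin n) :
    DifferentiableAt ℝ (fun w => gl w A B) z :=
  differentiableAt_of_contDiffOn h.isOpen (h.smooth_lower A B) hz

theorem differentiableAt_christ (h : IsMetricOn U g gl) (hz : z ∈ U) (A B C : Fin n) :
    DifferentiableAt ℝ (christ g gl A B C) z := by
  have hd := fun A B C => differentiableAt_of_contDiffOn h.isOpen
    (contDiffOn_pd h.isOpen (h.smooth_lower A B) C) hz
  have hlow : ∀ D, DifferentiableAt ℝ (christLow gl D B C) z := fun D => by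
    have := (((hd D C B).fun_add (hd D B C)).fun_sub (hd B C D)).mul_const (2 : ℝ)⁻¹
    simp only [← div_eq_mul_inv] at this
    exact this
  exact DifferentiableAt.fun_sum fun D _ => (h.differentiableAt_upper hz A D).fun_mul (hlow D)

theorem pd_lower_symm (h : IsMetricOn U g gl) (hz : z ∈ U) (A B C : Fin n) :
    pd A (fun u => gl u B C) z = pd A (fun u => gl u C B) z :=
  pd_congr_of_eqOn h.isOpen (fun _ hw => h.lower_symm hw B C) hz A

theorem christLow_symm (h : IsMetricOn U g gl) (hz : z ∈ U) (A B C : Fin n) :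
    christLow gl A B C z = christLow gl A C B z := by
  unfold christLow
  rw [h.pd_lower_symm hz A B C]
  ring

theorem christ_symm (h : IsMetricOn U g gl) (hz : z ∈ U) (A B C : Fin n) :
    christ g gl A B C z = christ g gl A C B z := by
  unfold christ
  exact sum_congr rfl fun D _ => by rw [h.christLow_symm hz]

theorem pd_lower (h : IsMetricOn U g gl) (hz : z ∈ U) (A B C : Fin n) :
    pd A (fun u => gl u B C) z = christLow gl B C A z + christLow gl C B A z := by
  unfold christLow
  rw [h.pd_lower_symm hz A C B, h.pd_lower_symm hz B C A, h.pd_lower_symm hz C B A]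
  ring

/-- Metric compatibility of the Levi–Civita connection in contravariant form. -/
theorem pd_upper (h : IsMetricOn U g gl) (hz : z ∈ U) (A B C : Fin n) :
    pd C (fun u => g u A B) z
      = -(∑ E, g z A E * christ g gl B E C z) - ∑ E, g z B E * christ g gl A E C z := by
  have hleib : ∀ E, ∑ F, gl z E F * pd C (fun u => g u F B) z
      = -∑ F, pd C (fun u => gl u E F) z * g z F B := by
    intro E
    have h1 : pd C (fun w => ∑ F, gl w E F * g w F B) z = 0 := by
      rw [pd_congr_of_eqOn h.isOpen (fun w hw => h.inv w hw E B) hz, pd_const]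
    rw [pd_sum _ fun F => (h.differentiableAt_lower hz E F).fun_mul
      (h.differentiableAt_upper hz F B)] at h1
    simp only [pd_mul (h.differentiableAt_lower hz _ _) (h.differentiableAt_upper hz _ _),
      sum_add_distrib] at h1
    linarith
  calc pd C (fun u => g u A B) z
      = ∑ F, (∑ E, g z A E * gl z E F) * pd C (fun u => g u F B) z := by
        simp [h.upper_mul_lower hz]
    _ = ∑ E, g z A E * ∑ F, gl z E F * pd C (fun u => g u F B) z := by
        simp only [sum_mul, mul_sum, mul_assoc]
        exact sum_comm
    _ = -(∑ E, g z A E * ∑ F, g z B F * christLow gl F E C z)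
          - ∑ E, g z A E * ∑ F, g z B F * christLow gl E F C z := by
        simp only [hleib, h.pd_lower hz, ← sum_neg_distrib, ← sum_sub_distrib, mul_sum]
        refine sum_congr rfl fun E _ => sum_congr rfl fun F _ => ?_
        rw [h.symm z hz F B]
        ring
    _ = _ := by
        unfold christ
        congr 1
        simp only [mul_sum]
        rw [sum_comm]
        exact sum_congr rfl fun E _ => sum_congr rfl fun F _ => by ring

/-- The contracted Christoffel symbols `Γ^C{}_{CA}` in terms of the metric. -/
theorem sum_christ_diag (h : IsMetricOn U g gl) (hz : z ∈ U) (A : Fin n) :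
    ∑ C, christ g gl C C A z
      = (∑ C, ∑ D, g z C D * pd A (fun u => gl u D C) z) / 2 := by
  have hswap : ∑ C, ∑ D, g z C D * pd C (fun u => gl u D A) z
      = ∑ C, ∑ D, g z C D * pd D (fun u => gl u C A) z := by
    rw [sum_comm]
    exact sum_congr rfl fun C _ => sum_congr rfl fun D _ => by rw [h.symm z hz]
  have hexp : ∑ C, christ g gl C C A z
      = (∑ C, ∑ D, g z C D * pd C (fun u => gl u D A) z
        + ∑ C, ∑ D, g z C D * pd A (fun u => gl u D C) z
        - ∑ C, ∑ D, g z C D * pd D (fun u => gl u C A) z) / 2 := by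
    unfold christ christLow
    simp only [← sum_add_distrib, ← sum_sub_distrib, sum_div]
    exact sum_congr rfl fun C _ => sum_congr rfl fun D _ => by ring
  rw [hexp, hswap]
  ring

theorem rhoG_pos (h : IsMetricOn U g gl) (hz : z ∈ U) : 0 < rhoG gl z :=
  Real.sqrt_pos.2 (h.pos z hz).det_pos

/-- `Γ^C{}_{CA} = ∂_A log ρ_g`, written for the half-density `√ρ_g`. -/
theorem pd_sqrt_rhoG (h : IsMetricOn U g gl) (hz : z ∈ U) (A : Fin n) :
    pd A (fun w => √(rhoG gl w)) z = √(rhoG gl z) * (∑ C, christ g gl C C A z) / 2 := by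
  have hpos : 0 < (Matrix.of (gl z)).det := (h.pos z hz).det_pos
  have hr : 0 < √(Matrix.of (gl z)).det := Real.sqrt_pos.2 hpos
  have hs : 0 < √√(Matrix.of (gl z)).det := Real.sqrt_pos.2 hr
  have hd : DifferentiableAt ℝ (fun w => (Matrix.of (gl w)).det) z :=
    differentiableAt_of_contDiffOn h.isOpen (contDiffOn_det h.smooth_lower) hz
  have hdet : pd A (fun w => (Matrix.of (gl w)).det) z
      = (Matrix.of (gl z)).det * (2 * ∑ C, christ g gl C C A z) := by
    rw [pd_det (M := fun w => Matrix.of (gl w)) (h.differentiableAt_lower hz),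
      h.sum_christ_diag hz, h.adjugate_lower hz]
    simp only [Matrix.smul_apply, Matrix.of_apply, smul_eq_mul, mul_assoc, ← mul_sum]
    ring
  have hsqrt : pd A (fun w => √√(Matrix.of (gl w)).det) z
      = 1 / (2 * √√(Matrix.of (gl z)).det) * (1 / (2 * √(Matrix.of (gl z)).det)
        * pd A (fun w => (Matrix.of (gl w)).det) z) := by
    unfold pd
    rw [((hd.hasFDerivAt.sqrt hpos.ne').sqrt hr.ne').fderiv]
    simp
  change pd A (fun w => √√(Matrix.of (gl w)).det) z
    = √√(Matrix.of (gl z)).det * (∑ C, christ g gl C C A z) / 2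
  rw [hsqrt, hdet]
  have e1 := Real.sq_sqrt hpos.le
  have e2 := Real.sq_sqrt hr.le
  generalize √√(Matrix.of (gl z)).det = s at *
  generalize √(Matrix.of (gl z)).det = r at *
  rw [← e1, ← e2]
  field_simp

theorem differentiableAt_christ_trace (h : IsMetricOn U g gl) (hz : z ∈ U) (A : Fin n) :
    DifferentiableAt ℝ (fun w => ∑ C, christ g gl C C A w) z :=
  DifferentiableAt.fun_sum fun C _ => h.differentiableAt_christ hz C C A

theorem differentiableAt_raised_trace (h : IsMetricOn U g gl) (hz : z ∈ U) (A : Fin n) :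
    DifferentiableAt ℝ (fun w => ∑ B, g w A B * ∑ C, christ g gl C C B w) z :=
  DifferentiableAt.fun_sum fun B _ =>
    (h.differentiableAt_upper hz A B).fun_mul (h.differentiableAt_christ_trace hz B)

/-- The divergence of the contravariant metric. -/
theorem sum_pd_upper (h : IsMetricOn U g gl) (hz : z ∈ U) (A : Fin n) :
    ∑ B, pd B (fun u => g u A B) z
      = -(∑ B, g z A B * ∑ C, christ g gl C C B z)
        - ∑ B, ∑ C, g z B C * christ g gl A B C z := by
  simp only [h.pd_upper hz, sum_sub_distrib, sum_neg_distrib]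
  refine congrArg₂ _ (congrArg _ ?_) ?_
  · rw [sum_comm]
    refine sum_congr rfl fun B _ => ?_
    rw [mul_sum]
    exact sum_congr rfl fun C _ => by rw [h.christ_symm hz]
  · exact sum_congr rfl fun B _ => sum_congr rfl fun C _ => by rw [h.christ_symm hz]

/-- `ν⁽⁰⁾` of the canonical density in terms of the contracted Christoffel symbols. -/
theorem nuZero_rhoG (h : IsMetricOn U g gl) (hz : z ∈ U) :
    nuZero (rhoG gl) g z
      = (∑ A, pd A (fun w => ∑ B, g w A B * ∑ C, christ g gl C C B w) z) / 2
        + (∑ A, (∑ B, g z A B * ∑ C, christ g gl C C B z) * ∑ C, christ g gl C C A z) / 4 := by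
  have hs : √(rhoG gl z) ≠ 0 := (Real.sqrt_pos.2 (h.rhoG_pos hz)).ne'
  have hds : DifferentiableAt ℝ (fun w => √(rhoG gl w)) z := by
    have hd : DifferentiableAt ℝ (fun w => (Matrix.of (gl w)).det) z :=
      differentiableAt_of_contDiffOn h.isOpen (contDiffOn_det h.smooth_lower) hz
    exact (hd.sqrt (h.pos z hz).det_pos.ne').sqrt (h.rhoG_pos hz).ne'
  have hterm : ∀ A B, pd A (fun w => 1 * g w A B * pd B (fun v => √(rhoG gl v)) w) z
      = √(rhoG gl z) * (pd A (fun w => g w A B * ∑ C, christ g gl C C B w) z / 2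
        + g z A B * (∑ C, christ g gl C C B z) * (∑ C, christ g gl C C A z) / 4) := by
    intro A B
    have hd : DifferentiableAt ℝ (fun w => g w A B * ∑ C, christ g gl C C B w) z :=
      (h.differentiableAt_upper hz A B).fun_mul (h.differentiableAt_christ_trace hz B)
    rw [pd_congr_of_eqOn h.isOpen (h := fun w => (√(rhoG gl w) * (1 / 2))
      * (g w A B * ∑ C, christ g gl C C B w)) (fun w hw => by rw [h.pd_sqrt_rhoG hw]; ring) hz,
      pd_mul (hds.fun_mul (differentiableAt_const _)) hd,
      pd_mul hds (differentiableAt_const _), pd_const, h.pd_sqrt_rhoG hz]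
    ring
  unfold nuZero lap
  simp only [hterm, ← mul_sum]
  rw [inv_one, one_mul, inv_mul_cancel_left₀ hs]
  simp only [sum_add_distrib, ← sum_div, ← sum_mul]
  congr 2
  refine sum_congr rfl fun A _ => ?_
  rw [pd_sum _ fun B =>
    (h.differentiableAt_upper hz A B).fun_mul (h.differentiableAt_christ_trace hz B)]

/-- The contraction `g^{BC} ∂_A Γ^A{}_{BC}`. -/
theorem sum_upper_mul_pd_christ (h : IsMetricOn U g gl) (hz : z ∈ U) :
    ∑ A, ∑ B, ∑ C, g z B C * pd A (christ g gl A B C) z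
      = -nuOne g z - ∑ A, pd A (fun w => ∑ B, g w A B * ∑ C, christ g gl C C B w) z
        + 2 * ∑ A, ∑ B, ∑ C, ∑ D, g z A B * christ g gl D B C z * christ g gl C D A z := by
  have hdiv : ∀ A, ∑ B, ∑ C, (pd A (fun u => g u B C) z * christ g gl A B C z
        + g z B C * pd A (christ g gl A B C) z)
      = -(∑ B, pd A (pd B (fun u => g u A B)) z)
        - pd A (fun w => ∑ B, g w A B * ∑ C, christ g gl C C B w) z := by
    intro A
    have hd : ∀ B C, DifferentiableAt ℝ (fun w => g w B C * christ g gl A B C w) z := fun B C =>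
      (h.differentiableAt_upper hz B C).fun_mul (h.differentiableAt_christ hz A B C)
    have hdg : ∀ B, DifferentiableAt ℝ (pd B (fun u => g u A B)) z := fun B =>
      differentiableAt_of_contDiffOn h.isOpen (contDiffOn_pd h.isOpen (h.smooth A B) B) hz
    calc _ = pd A (fun w => ∑ B, ∑ C, g w B C * christ g gl A B C w) z := by
          rw [pd_sum _ fun B => DifferentiableAt.fun_sum fun C _ => hd B C]
          refine sum_congr rfl fun B _ => ?_
          rw [pd_sum _ (hd B)]
          refine sum_congr rfl fun C _ => ?_
          exact (pd_mul (h.differentiableAt_upper hz B C)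
            (h.differentiableAt_christ hz A B C) A).symm
      _ = pd A (fun w => -(∑ B, pd B (fun u => g u A B) w)
            - ∑ B, g w A B * ∑ C, christ g gl C C B w) z :=
          pd_congr_of_eqOn h.isOpen (fun w hw => by rw [h.sum_pd_upper hw]; ring) hz A
      _ = _ := by
          rw [pd_neg_sub (DifferentiableAt.fun_sum fun B _ => hdg B)
            (h.differentiableAt_raised_trace hz A), pd_sum _ hdg]
  have hquad : ∑ A, ∑ B, ∑ C, pd A (fun u => g u B C) z * christ g gl A B C z
      = -(2 * ∑ A, ∑ B, ∑ C, ∑ D,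
          g z A B * christ g gl D B C z * christ g gl C D A z) := by
    have h1 : ∑ A, ∑ B, ∑ C, (∑ E, g z B E * christ g gl C E A z) * christ g gl A B C z
        = ∑ A, ∑ B, ∑ C, ∑ D, g z A B * christ g gl D B C z * christ g gl C D A z := by
      simp only [sum_mul]
      rw [sum_comm]
      refine sum_congr rfl fun B _ => ?_
      calc _ = ∑ A, ∑ E, ∑ C, g z B E * christ g gl C E A z * christ g gl A B C z :=
            sum_congr rfl fun A _ => sum_comm
        _ = ∑ E, ∑ A, ∑ C, g z B E * christ g gl C E A z * christ g gl A B C z := sum_comm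
        _ = _ := sum_congr rfl fun E _ => sum_congr rfl fun A _ => sum_congr rfl fun C _ => by
            rw [h.christ_symm hz A B C]
    have h2 : ∑ A, ∑ B, ∑ C, (∑ E, g z C E * christ g gl B E A z) * christ g gl A B C z
        = ∑ A, ∑ B, ∑ C, ∑ D, g z A B * christ g gl D B C z * christ g gl C D A z := by
      rw [← h1]
      refine sum_congr rfl fun A _ => ?_
      rw [sum_comm]
      exact sum_congr rfl fun C _ => sum_congr rfl fun B _ => by rw [h.christ_symm hz A B C]
    simp only [h.pd_upper hz, sub_mul, neg_mul, sum_sub_distrib, sum_neg_distrib]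
    rw [h1, h2]
    ring
  have hsum := sum_congr (rfl : (univ : Finset (Fin n)) = univ) fun A _ => hdiv A
  simp only [sum_add_distrib, sum_sub_distrib, sum_neg_distrib] at hsum
  unfold nuOne
  linarith

/-- The contraction `g^{AB} ∂_A Γ^C{}_{CB}`. -/
theorem sum_upper_mul_pd_trace (h : IsMetricOn U g gl) (hz : z ∈ U) :
    ∑ A, ∑ B, g z A B * ∑ C, pd A (christ g gl C C B) z
      = ∑ A, pd A (fun w => ∑ B, g w A B * ∑ C, christ g gl C C B w) z
        + (∑ A, (∑ B, g z A B * ∑ C, christ g gl C C B z) * ∑ C, christ g gl C C A z)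
        + ∑ A, (∑ B, ∑ C, g z B C * christ g gl A B C z) * ∑ C, christ g gl C C A z := by
  have hexp : ∀ A, pd A (fun w => ∑ B, g w A B * ∑ C, christ g gl C C B w) z
      = ∑ B, pd A (fun u => g u A B) z * (∑ C, christ g gl C C B z)
        + ∑ B, g z A B * ∑ C, pd A (christ g gl C C B) z := by
    intro A
    rw [pd_sum _ fun B =>
      (h.differentiableAt_upper hz A B).fun_mul (h.differentiableAt_christ_trace hz B),
      ← sum_add_distrib]
    refine sum_congr rfl fun B _ => ?_
    rw [pd_mul (h.differentiableAt_upper hz A B) (h.differentiableAt_christ_trace hz B),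
      pd_sum _ fun C => h.differentiableAt_christ hz C C B]
  have hdiv : ∑ A, ∑ B, pd A (fun u => g u A B) z * (∑ C, christ g gl C C B z)
      = ∑ B, (-(∑ A, g z B A * ∑ C, christ g gl C C A z)
        - ∑ A, ∑ C, g z A C * christ g gl B A C z) * ∑ C, christ g gl C C B z := by
    rw [sum_comm]
    refine sum_congr rfl fun B _ => ?_
    rw [← sum_mul, ← h.sum_pd_upper hz]
    congr 1
    exact sum_congr rfl fun A _ =>
      pd_congr_of_eqOn h.isOpen (fun w hw => h.symm w hw A B) hz A
  simp only [hexp, sum_add_distrib]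
  rw [hdiv]
  simp only [sub_mul, neg_mul, sum_sub_distrib, sum_neg_distrib]
  ring

theorem scal_eq (h : IsMetricOn U g gl) (hz : z ∈ U) :
    scal g gl z
      = ∑ A, ∑ B, ∑ C, g z B C * pd A (christ g gl A B C) z
        - ∑ A, ∑ B, g z A B * ∑ C, pd A (christ g gl C C B) z
        + ∑ A, (∑ B, ∑ C, g z B C * christ g gl A B C z) * ∑ C, christ g gl C C A z
        - ∑ A, ∑ B, ∑ C, ∑ D, g z A B * christ g gl D B C z * christ g gl C D A z := by
  have h1 : ∑ A, ∑ B, ∑ C, g z B C * pd A (christ g gl A B C) z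
      = ∑ A, ∑ B, ∑ C, g z B A * pd C (christ g gl C A B) z := by
    rw [sum_comm]
    refine sum_congr rfl fun A _ => ?_
    rw [sum_comm]
    exact sum_congr rfl fun B _ => sum_congr rfl fun C _ => by rw [h.symm z hz]
  have h2 : ∑ A, ∑ B, g z A B * ∑ C, pd A (christ g gl C C B) z
      = ∑ A, ∑ B, ∑ C, g z B A * pd A (christ g gl C C B) z := by
    simp only [mul_sum]
    exact sum_congr rfl fun A _ => sum_congr rfl fun B _ => sum_congr rfl fun C _ => by
      rw [h.symm z hz]
  have h3 : ∑ A, (∑ B, ∑ C, g z B C * christ g gl A B C z) * ∑ C, christ g gl C C A z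
      = ∑ A, ∑ B, ∑ C, ∑ E, g z B A * (christ g gl C C E z * christ g gl E A B z) := by
    calc _ = ∑ E, ∑ A, ∑ B, ∑ C, g z B A * (christ g gl C C E z * christ g gl E A B z) := by
          refine sum_congr rfl fun E _ => ?_
          rw [sum_mul]
          refine sum_congr rfl fun A _ => ?_
          rw [sum_mul]
          refine sum_congr rfl fun B _ => ?_
          rw [mul_sum]
          exact sum_congr rfl fun C _ => by rw [h.symm z hz A B]; ring
      _ = ∑ A, ∑ E, ∑ B, ∑ C, g z B A * (christ g gl C C E z * christ g gl E A B z) := sum_comm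
      _ = ∑ A, ∑ B, ∑ E, ∑ C, g z B A * (christ g gl C C E z * christ g gl E A B z) :=
          sum_congr rfl fun A _ => sum_comm
      _ = _ := sum_congr rfl fun A _ => sum_congr rfl fun B _ => sum_comm
  have h4 : ∑ A, ∑ B, ∑ C, ∑ D, g z A B * christ g gl D B C z * christ g gl C D A z
      = ∑ A, ∑ B, ∑ C, ∑ E, g z B A * (christ g gl C A E z * christ g gl E C B z) := by
    refine sum_congr rfl fun A _ => sum_congr rfl fun B _ => sum_congr rfl fun C _ =>
      sum_congr rfl fun D _ => ?_
    rw [h.symm z hz A B, h.christ_symm hz D B C, h.christ_symm hz C D A]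
    ring
  rw [h1, h2, h3, h4]
  unfold scal ricci riem
  simp only [mul_sum, mul_add, mul_sub, sum_add_distrib, sum_sub_distrib]
  ring

end IsMetricOn

/-- the Levi–Civita scalar curvature satisfies
`R = −4·ν⁽⁰⁾_{ρ_g} − ν⁽¹⁾ + Σ_{A,B,C,D} g^{AB}·Γ^D{}_{BC}·Γ^C{}_{DA}` pointwise on `U`. -/
theorem stmt5 {n : ℕ} (U : Set (Fin n → ℝ)) (hU : IsOpen U)
    (g gl : (Fin n → ℝ) → Fin n → Fin n → ℝ)
    (hg : ∀ A B, ContDiffOn ℝ (⊤ : ℕ∞) (fun z => g z A B) U)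
    (hgsymm : ∀ z ∈ U, ∀ A B, g z A B = g z B A)
    (hginv : ∀ z ∈ U, ∀ A C, ∑ B, gl z A B * g z B C = if A = C then 1 else 0)
    (hgpos : ∀ z ∈ U, (Matrix.of fun A B => gl z A B).PosDef) :
    ∀ z ∈ U,
      scal g gl z
        = -4 * nuZero (rhoG gl) g z - nuOne g z
          + ∑ A, ∑ B, ∑ C, ∑ D, g z A B * christ g gl D B C z * christ g gl C D A z := by
  intro z hz
  have h : IsMetricOn U g gl := ⟨hU, hg, hgsymm, hginv, hgpos⟩
  rw [h.scal_eq hz, h.sum_upper_mul_pd_christ hz, h.sum_upper_mul_pd_trace hz, h.nuZero_rhoG hz]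
  ring
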